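/- Let f_1, ..., f_n be multiplicative arithmetic functions such that the pointwise product g(k) = ∏_{i=1}^{n} f_i(k) belongs to the universality class ℬ{N^{a1}(log N)^{b1}; N^{−a2}(log N)^{−b2}} with admissible parameters. Let p be a prime and m_1, ..., m_n ≥ 0 integers, and suppose there exist real numbers K > 0 and γ < a1 and an integer r* ≥ 0 such that |L_r(∏f_i;p^𝐦)| ≤ K·p^{γr} for all r ≥ r*. Then [∑_{k=1}^{N} ∏_{i=1}^{n} f_i(k·p^{m_i})] / [∑_{k=1}^{N} ∏_{i=1}^{n} f_i(k)] tends to ∑_{r=0}^{∞} L_r(∏f_i;p^𝐦)·p^{−a1·r} as N → ∞. -/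

import Mathlib

open Filter

/-- `f` is a multiplicative arithmetic function on the positive integers. -/
def IsMultiplicativeFn (f : ℕ → ℝ) : Prop :=
  f 1 = 1 ∧ ∀ a b : ℕ, 0 < a → 0 < b → Nat.gcd a b = 1 → f (a * b) = f a * f b

/-- Admissible parameters. -/
def AdmissibleParams (a1 b1 a2 b2 : ℝ) : Prop :=
  (0 < a1 ∨ (a1 = 0 ∧ 0 ≤ b1)) ∧ (0 < a2 ∨ (a2 = 0 ∧ 0 < b2))

/-- `g` belongs to the universality class `ℬ{N^{a1}(log N)^{b1}; N^{-a2}(log N)^{-b2}}`. -/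
def InUniversalityClass (g : ℕ → ℝ) (a1 b1 a2 b2 : ℝ) : Prop :=
  ∃ Fc C : ℝ, 0 < Fc ∧ 0 < C ∧
    Tendsto (fun N : ℕ =>
        (∑ k ∈ Finset.Icc 1 N, g k) / (Fc * (N : ℝ) ^ a1 * Real.log N ^ b1))
      atTop (nhds 1) ∧
    ∀ᶠ N : ℕ in atTop,
      |(∑ k ∈ Finset.Icc 1 N, g k) / (Fc * (N : ℝ) ^ a1 * Real.log N ^ b1) - 1|
        < C * (N : ℝ) ^ (-a2) * Real.log N ^ (-b2)

/-- Characteristic functions `L_r(∏ f_i; p^𝐦)` for a tuple of multiplicative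
functions scaled by `p^{m_i}` respectively. -/
noncomputable def charLProd {n : ℕ} (f : Fin n → ℕ → ℝ) (p : ℕ) (m : Fin n → ℕ) :
    ℕ → ℝ
  | 0 => ∏ i, f i (p ^ m i)
  | r + 1 =>
      (∏ i, f i (p ^ (m i + (r + 1)))) -
        ∑ j : Fin (r + 1), charLProd f p m j * ∏ i, f i (p ^ (r + 1 - (j : ℕ)))
  decreasing_by exact j.isLt

lemma aux_charL {n : ℕ} (f : Fin n → ℕ → ℝ) (p : ℕ) (m : Fin n → ℕ)
    (hf : ∀ i, IsMultiplicativeFn (f i)) (v : ℕ) :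
    ∏ i, f i (p ^ (m i + v)) =
      ∑ j ∈ Finset.range (v + 1), charLProd f p m j * ∏ i, f i (p ^ (v - j)) := by
  have h1 : ∏ i, f i 1 = 1 := Finset.prod_eq_one (fun i _ => (hf i).1)
  cases v with
  | zero => simp [charLProd, h1]
  | succ r =>
    rw [Finset.sum_range_succ]
    rw [charLProd.eq_2 f p m r]
    rw [Finset.sum_range (fun j => charLProd f p m j * ∏ i, f i (p ^ (r + 1 - j)))]
    simp [h1]

lemma aux_pt {n : ℕ} (f : Fin n → ℕ → ℝ) (p : ℕ) (m : Fin n → ℕ)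
    (hf : ∀ i, IsMultiplicativeFn (f i)) (hp : p.Prime) (N k : ℕ) (hk : 0 < k) (hkN : k ≤ N) :
    ∏ i, f i (k * p ^ m i) =
      ∑ j ∈ Finset.range (N + 1), charLProd f p m j *
        (if p ^ j ∣ k then ∏ i, f i (k / p ^ j) else 0) := by
  obtain ⟨v, k', hk', rfl⟩ := Nat.exists_eq_pow_mul_and_not_dvd hk.ne' p hp.ne_one
  have hk0 : 0 < k' := Nat.pos_of_ne_zero (by rintro rfl; simp at hk')
  have hcop : Nat.Coprime p k' := (Nat.Prime.coprime_iff_not_dvd hp).2 hk'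
  have key : ∀ s, ∀ i, f i (p ^ s * k') = f i (p ^ s) * f i k' := fun s i =>
    (hf i).2 _ _ (pow_pos hp.pos _) hk0 (Nat.Coprime.pow_left s hcop)
  have hvN : v ≤ N := by
    have h1 : v < p ^ v := Nat.lt_pow_self hp.one_lt
    have h2 : p ^ v ≤ p ^ v * k' := Nat.le_mul_of_pos_right _ hk0
    omega
  have hdvd : ∀ j, p ^ j ∣ p ^ v * k' ↔ j ≤ v := by
    intro j
    constructor
    · intro h
      have h2 : p ^ j ∣ p ^ v := Nat.Coprime.dvd_of_dvd_mul_right (Nat.Coprime.pow_left j hcop) h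
      exact (Nat.pow_dvd_pow_iff_le_right hp.one_lt).1 h2
    · intro h
      exact Dvd.dvd.mul_right (pow_dvd_pow p h) _
  have hsub : Finset.range (v + 1) ⊆ Finset.range (N + 1) := by
    intro x; simp; omega
  rw [← Finset.sum_subset hsub]
  · have : ∀ i, f i (p ^ v * k' * p ^ m i) = f i (p ^ (m i + v)) * f i k' := by
      intro i
      rw [← key]; congr 1; ring
    simp_rw [this]
    rw [Finset.prod_mul_distrib, aux_charL f p m hf v, Finset.sum_mul]
    refine Finset.sum_congr rfl fun j hj => ?_
    have hj' : j ≤ v := by simp at hj; omega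
    rw [if_pos ((hdvd j).2 hj')]
    have : p ^ v * k' / p ^ j = p ^ (v - j) * k' := by
      apply Nat.div_eq_of_eq_mul_right (pow_pos hp.pos _)
      rw [← mul_assoc, ← pow_add]; congr 2; omega
    rw [this]
    simp_rw [key]
    rw [Finset.prod_mul_distrib, mul_assoc]
  · intro j _ hj
    rw [if_neg, mul_zero]
    rw [hdvd]; simp at hj; omega

lemma aux_reindex (g : ℕ → ℝ) (q N : ℕ) (hq : 0 < q) :
    ∑ k ∈ Finset.Icc 1 N, (if q ∣ k then g (k / q) else 0) = ∑ l ∈ Finset.Icc 1 (N / q), g l := by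
  rw [← Finset.sum_filter]
  symm
  refine Finset.sum_nbij (fun l => q * l) ?_ ?_ ?_ ?_
  · intro l hl
    simp only [Finset.mem_Icc, Finset.mem_filter] at hl ⊢
    refine ⟨⟨Nat.mul_pos hq hl.1, ?_⟩, dvd_mul_right _ _⟩
    have := (Nat.le_div_iff_mul_le hq).1 hl.2
    linarith
  · intro a _ b _ h
    exact Nat.eq_of_mul_eq_mul_left hq h
  · intro k hk
    simp only [Finset.coe_filter, Finset.mem_Icc, Set.mem_ofPred_eq] at hk
    obtain ⟨⟨h1, h2⟩, l, rfl⟩ := hk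
    refine ⟨l, ?_, rfl⟩
    simp only [Finset.coe_Icc, Set.mem_Icc]
    refine ⟨Nat.pos_of_ne_zero (by rintro rfl; simp at h1), ?_⟩
    rw [Nat.le_div_iff_mul_le hq]; linarith
  · intro l _
    simp [Nat.mul_div_cancel_left l hq]

lemma aux_T {n : ℕ} (f : Fin n → ℕ → ℝ) (p : ℕ) (m : Fin n → ℕ)
    (hf : ∀ i, IsMultiplicativeFn (f i)) (hp : p.Prime) (N : ℕ) :
    ∑ k ∈ Finset.Icc 1 N, ∏ i, f i (k * p ^ m i) =
      ∑ j ∈ Finset.range (N + 1), charLProd f p m j *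
        ∑ l ∈ Finset.Icc 1 (N / p ^ j), ∏ i, f i l := by
  rw [Finset.sum_congr rfl (fun k hk => aux_pt f p m hf hp N k
    (Finset.mem_Icc.1 hk).1 (Finset.mem_Icc.1 hk).2)]
  rw [Finset.sum_comm]
  refine Finset.sum_congr rfl fun j _ => ?_
  rw [← Finset.mul_sum, aux_reindex (fun k => ∏ i, f i k) _ _ (pow_pos hp.pos _)]

/-- comparison function -/
noncomputable def UU (a b : ℝ) (N : ℕ) : ℝ := (N : ℝ) ^ a * (1 + Real.log N) ^ b

lemma one_le_log (N : ℕ) : 1 ≤ 1 + Real.log N := by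
  have := Real.log_natCast_nonneg N; linarith

lemma UU_pos (a b : ℝ) (N : ℕ) (hN : 0 < N) : 0 < UU a b N := by
  have := one_le_log N
  unfold UU
  have : (0 : ℝ) < N := by exact_mod_cast hN
  positivity

lemma tendsto_log_top : Tendsto (fun N : ℕ => 1 + Real.log N) atTop atTop :=
  tendsto_atTop_add_const_left _ _ (Real.tendsto_log_atTop.comp tendsto_natCast_atTop_atTop)

lemma SU_tendsto (S : ℕ → ℝ) (F a b : ℝ) (hF : 0 < F)
    (h : Tendsto (fun N : ℕ => S N / (F * (N : ℝ) ^ a * Real.log N ^ b)) atTop (nhds 1)) :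
    Tendsto (fun N => S N / UU a b N) atTop (nhds F) := by
  have h1 : Tendsto (fun N : ℕ => 1 - (1 + Real.log N)⁻¹) atTop (nhds (1 - 0)) :=
    tendsto_const_nhds.sub (tendsto_inv_atTop_zero.comp tendsto_log_top)
  rw [sub_zero] at h1
  have h2 := h1.rpow_const (p := b) (Or.inl one_ne_zero)
  have h3 := (h.mul h2).const_mul F
  simp only [Real.one_rpow, mul_one] at h3
  refine h3.congr' ?_
  filter_upwards [eventually_ge_atTop 2] with N hN
  have hN' : (0 : ℝ) < N := by positivity
  have hl : 0 < Real.log N := Real.log_pos (by exact_mod_cast hN)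
  have : 1 - (1 + Real.log N)⁻¹ = Real.log N / (1 + Real.log N) := by field_simp; ring
  rw [this, Real.div_rpow hl.le (by positivity), UU]
  have e1 : 0 < Real.log N ^ b := by positivity
  have e2 : 0 < (1 + Real.log N) ^ b := by positivity
  have e3 : 0 < (N : ℝ) ^ a := by positivity
  field_simp

lemma ratio_tendsto (q : ℕ) (hq : 0 < q) :
    Tendsto (fun N : ℕ => ((N / q : ℕ) : ℝ) / N) atTop (nhds ((q : ℝ)⁻¹)) := by
  have := (tendsto_nat_floor_mul_div_atTop (R := ℝ) (a := (q : ℝ)⁻¹) (by positivity)).comp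
    tendsto_natCast_atTop_atTop
  refine this.congr fun N => ?_
  simp only [Function.comp]
  rw [← Nat.floor_div_eq_div (K := ℝ) N q, inv_mul_eq_div]

lemma div_top (q : ℕ) (hq : 0 < q) : Tendsto (fun N : ℕ => N / q) atTop atTop :=
  Nat.tendsto_div_const_atTop hq.ne'

lemma UU_ratio (a b : ℝ) (q : ℕ) (hq : 0 < q) :
    Tendsto (fun N : ℕ => UU a b (N / q) / UU a b N) atTop (nhds ((q : ℝ) ^ (-a))) := by
  have hq' : (0 : ℝ) < q := by exact_mod_cast hq
  have hr := ratio_tendsto q hq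
  have h1 := hr.rpow_const (p := a) (Or.inl (by positivity))
  have h2 : Tendsto (fun N : ℕ => 1 + Real.log (((N / q : ℕ) : ℝ) / N) * (1 + Real.log N)⁻¹)
      atTop (nhds (1 + Real.log ((q : ℝ)⁻¹) * 0)) :=
    tendsto_const_nhds.add ((hr.log (by positivity)).mul
      (tendsto_inv_atTop_zero.comp tendsto_log_top))
  rw [mul_zero, add_zero] at h2
  have h3 := h1.mul (h2.rpow_const (p := b) (Or.inl one_ne_zero))
  rw [Real.one_rpow, mul_one, Real.inv_rpow hq'.le, ← Real.rpow_neg hq'.le] at h3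
  refine h3.congr' ?_
  filter_upwards [eventually_ge_atTop 1, (div_top q hq).eventually_ge_atTop 1] with N hN hM
  set M := N / q
  have hN' : (0 : ℝ) < N := by exact_mod_cast hN
  have hM' : (0 : ℝ) < M := by exact_mod_cast hM
  have hlN := one_le_log N
  have hlM := one_le_log M
  have : 1 + Real.log ((M : ℝ) / N) * (1 + Real.log N)⁻¹ = (1 + Real.log M) / (1 + Real.log N) := by
    rw [Real.log_div hM'.ne' hN'.ne']
    have : 1 + Real.log N ≠ 0 := by positivity
    field_simp; ring
  rw [this, Real.div_rpow (by positivity) (by positivity), Real.div_rpow (by positivity) (by positivity),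
    UU, UU, div_mul_div_comm]

lemma UU_bound (a b ε : ℝ) (ha : 0 ≤ a) (hε : 0 < ε) :
    ∃ C : ℝ, 0 < C ∧ ∀ N q : ℕ, 0 < q → 0 < N / q →
      UU a b (N / q) / UU a b N ≤ C * ((q : ℝ) ^ (-a) * (q : ℝ) ^ ε) := by
  set c := |b| + 1 with hc
  have hc0 : 0 < c := by positivity
  refine ⟨(1 + c / ε) ^ c * 2 ^ ε, by positivity, ?_⟩
  intro N q hq hM
  set M := N / q with hMdef
  have hMN : M ≤ N := Nat.div_le_self _ _
  have hN : 0 < N := lt_of_lt_of_le hM hMN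
  have hq' : (0 : ℝ) < q := by exact_mod_cast hq
  have hN' : (0 : ℝ) < N := by exact_mod_cast hN
  have hM' : (0 : ℝ) < M := by exact_mod_cast hM
  have hMN' : (M : ℝ) ≤ N := by exact_mod_cast hMN
  have hlN := one_le_log N
  have hlM := one_le_log M
  have hMq : (M : ℝ) * q ≤ N := by exact_mod_cast Nat.div_mul_le_self N q
  have hNM : (N : ℝ) ≤ 2 * q * M := by
    have h1 : N < M * q + q := by
      have := Nat.lt_div_mul_add (a := N) hq
      exact this
    have h2 : q ≤ M * q := Nat.le_mul_of_pos_left q hM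
    have : N ≤ 2 * q * M := by nlinarith
    exact_mod_cast this
  set y : ℝ := N / M with hy
  have hy1 : 1 ≤ y := by rw [hy, le_div_iff₀ hM']; linarith
  have hyq : y ≤ 2 * q := by rw [hy, div_le_iff₀ hM']; linarith
  have hly : Real.log y = Real.log N - Real.log M := Real.log_div hN'.ne' hM'.ne'
  have hly0 : 0 ≤ Real.log y := Real.log_nonneg hy1
  set R : ℝ := (1 + Real.log N) / (1 + Real.log M) with hR
  have hR1 : 1 ≤ R := by rw [hR, le_div_iff₀ (by positivity)]; linarith
  have hR2 : R ≤ 1 + Real.log y := by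
    rw [hR, div_le_iff₀ (by positivity)]
    nlinarith
  have hR3 : R ≤ (1 + c / ε) * y ^ (ε / c) := by
    have h1 := Real.log_le_rpow_div (x := y) (by positivity) (div_pos hε hc0)
    have h2 : 1 ≤ y ^ (ε / c) := Real.one_le_rpow hy1 (by positivity)
    have h3 : y ^ (ε / c) / (ε / c) = c / ε * y ^ (ε / c) := by field_simp
    linarith
  have hRb : R ^ (-b) ≤ (1 + c / ε) ^ c * (2 ^ ε * (q : ℝ) ^ ε) := by
    calc R ^ (-b) ≤ R ^ c := Real.rpow_le_rpow_of_exponent_le hR1 (by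
            have := neg_abs_le b; linarith)
      _ ≤ ((1 + c / ε) * y ^ (ε / c)) ^ c := Real.rpow_le_rpow (by positivity) hR3 hc0.le
      _ = (1 + c / ε) ^ c * y ^ ε := by
          rw [Real.mul_rpow (by positivity) (by positivity), ← Real.rpow_mul (by positivity)]
          congr 2; field_simp
      _ ≤ (1 + c / ε) ^ c * (2 * q) ^ ε := by gcongr
      _ = _ := by rw [Real.mul_rpow (by positivity) (by positivity)]
  have hMa : ((M : ℝ) / N) ^ a ≤ (q : ℝ) ^ (-a) := by
    rw [Real.rpow_neg hq'.le, ← Real.inv_rpow hq'.le]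
    refine Real.rpow_le_rpow (by positivity) ?_ ha
    rw [div_le_iff₀ hN', inv_mul_eq_div, le_div_iff₀ hq']; exact hMq
  have hU : UU a b M / UU a b N = ((M : ℝ) / N) ^ a * R ^ (-b) := by
    rw [Real.rpow_neg (by positivity), ← Real.inv_rpow (by positivity), hR, inv_div,
      Real.div_rpow (by positivity) (by positivity), Real.div_rpow (by positivity) (by positivity),
      UU, UU, div_mul_div_comm]
  rw [hU]
  calc ((M : ℝ) / N) ^ a * R ^ (-b) ≤ (q : ℝ) ^ (-a) * ((1 + c / ε) ^ c * (2 ^ ε * (q : ℝ) ^ ε)) := by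
        gcongr
    _ = _ := by ring

lemma S_limit (S : ℕ → ℝ) (F a b : ℝ) (hF : 0 < F) (q : ℕ) (hq : 0 < q)
    (h : Tendsto (fun N => S N / UU a b N) atTop (nhds F)) :
    Tendsto (fun N => S (N / q) / S N) atTop (nhds ((q : ℝ) ^ (-a))) := by
  have h1 := ((h.comp (div_top q hq)).mul (UU_ratio a b q hq)).div h hF.ne'
  rw [mul_div_cancel_left₀ _ hF.ne'] at h1
  refine h1.congr' ?_
  filter_upwards [eventually_ge_atTop 1, (div_top q hq).eventually_ge_atTop 1] with N hN hM
  have e1 := UU_pos a b N hN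
  have e2 := UU_pos a b (N / q) hM
  simp only [Function.comp, Pi.div_apply]
  field_simp

lemma S_bound (S : ℕ → ℝ) (F a b ε : ℝ) (hF : 0 < F) (ha : 0 ≤ a) (hε : 0 < ε) (h0 : S 0 = 0)
    (h : Tendsto (fun N => S N / UU a b N) atTop (nhds F)) :
    ∃ C : ℝ, 0 < C ∧ ∀ᶠ N : ℕ in atTop, ∀ q : ℕ, 0 < q →
      |S (N / q) / S N| ≤ C * ((q : ℝ) ^ (-a) * (q : ℝ) ^ ε) := by
  obtain ⟨C, hC, hU⟩ := UU_bound a b ε ha hε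
  obtain ⟨B, hB⟩ := h.abs.bddAbove_range
  have hB' : ∀ N, |S N / UU a b N| ≤ B := fun N => hB ⟨N, rfl⟩
  have hB0 : 0 ≤ B := (abs_nonneg _).trans (hB' 0)
  refine ⟨(B + 1) * (2 / F) * C, by positivity, ?_⟩
  filter_upwards [h.eventually (lt_mem_nhds (half_lt_self hF)), eventually_ge_atTop 1] with N hN hN1 q hq
  rcases Nat.eq_zero_or_pos (N / q) with hM | hM
  · rw [hM, h0, zero_div, abs_zero]; positivity
  have e1 := UU_pos a b N hN1
  have e2 := UU_pos a b (N / q) hM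
  have hS : 0 < S N := by
    rw [lt_div_iff₀ e1] at hN
    have : 0 < F / 2 * UU a b N := by positivity
    linarith
  have h3 : S (N / q) / S N = S (N / q) / UU a b (N / q) * (UU a b N / S N) *
      (UU a b (N / q) / UU a b N) := by field_simp
  have h4 : UU a b N / S N ≤ 2 / F := by
    rw [lt_div_iff₀ e1] at hN
    rw [div_le_div_iff₀ hS hF]
    linarith
  rw [h3, abs_mul, abs_mul, abs_of_pos (div_pos e1 hS), abs_of_pos (div_pos e2 e1)]
  calc _ ≤ (B + 1) * (2 / F) * (C * ((q : ℝ) ^ (-a) * (q : ℝ) ^ ε)) := by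
        have := hU N q hq hM
        have := hB' (N / q)
        gcongr
        linarith
    _ = _ := by ring

lemma L_bound (L : ℕ → ℝ) (p : ℕ) (hp : 0 < p) (K γ : ℝ) (hK : 0 < K) (rstar : ℕ)
    (hL : ∀ r : ℕ, rstar ≤ r → |L r| ≤ K * (p : ℝ) ^ (γ * r)) :
    ∃ K' : ℝ, 0 < K' ∧ ∀ r : ℕ, |L r| ≤ K' * (p : ℝ) ^ (γ * r) := by
  have hp' : (0 : ℝ) < p := by exact_mod_cast hp
  have hnn : ∀ r ∈ Finset.range rstar, 0 ≤ |L r| / (p : ℝ) ^ (γ * r) := fun r _ => by positivity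
  have hs := Finset.sum_nonneg hnn
  refine ⟨K + ∑ r ∈ Finset.range rstar, |L r| / (p : ℝ) ^ (γ * r), by positivity, fun r => ?_⟩
  have hpp : 0 < (p : ℝ) ^ (γ * r) := by positivity
  rcases le_or_gt rstar r with h | h
  · refine (hL r h).trans ?_
    gcongr; linarith
  · rw [← div_le_iff₀ hpp]
    have := Finset.single_le_sum hnn (Finset.mem_range.2 h)
    linarith

/-- Theorem 4 of the paper: renormalization of the summatory function
`∑_{k ≤ N} ∏ f_i(k p^{m_i})`. -/
theorem renormalization_product_of_functions
    (n : ℕ) (f : Fin n → ℕ → ℝ) (a1 b1 a2 b2 : ℝ) (p : ℕ) (m : Fin n → ℕ)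
    (hf : ∀ i, IsMultiplicativeFn (f i)) (hp : p.Prime)
    (hadm : AdmissibleParams a1 b1 a2 b2)
    (hclass : InUniversalityClass (fun k => ∏ i, f i k) a1 b1 a2 b2)
    (K γ : ℝ) (hK : 0 < K) (hγ : γ < a1) (rstar : ℕ)
    (hL : ∀ r : ℕ, rstar ≤ r → |charLProd f p m r| ≤ K * (p : ℝ) ^ (γ * r)) :
    Tendsto (fun N : ℕ =>
        (∑ k ∈ Finset.Icc 1 N, ∏ i, f i (k * p ^ m i)) /
          (∑ k ∈ Finset.Icc 1 N, ∏ i, f i k))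
      atTop
      (nhds (∑' r : ℕ, charLProd f p m r * (p : ℝ) ^ (-(a1 * r)))) := by
  obtain ⟨F, _, hF, _, hlim, _⟩ := hclass
  have ha : 0 ≤ a1 := by
    rcases hadm.1 with h | h
    · exact h.le
    · exact h.1.ge
  set S : ℕ → ℝ := fun N => ∑ k ∈ Finset.Icc 1 N, ∏ i, f i k with hSdef
  have hS0 : S 0 = 0 := by simp [hSdef]
  have hSU : Tendsto (fun N => S N / UU a1 b1 N) atTop (nhds F) := SU_tendsto S F a1 b1 hF hlim
  have hp' : (0 : ℝ) < p := by exact_mod_cast hp.pos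
  obtain ⟨K', hK', hL'⟩ := L_bound (charLProd f p m) p hp.pos K γ hK rstar hL
  set ε := (a1 - γ) / 2 with hε
  have hε0 : 0 < ε := by rw [hε]; linarith
  obtain ⟨C, hC, hb⟩ := S_bound S F a1 b1 ε hF ha hε0 hS0 hSU
  have hT : ∀ N : ℕ, (∑ k ∈ Finset.Icc 1 N, ∏ i, f i (k * p ^ m i)) / (∑ k ∈ Finset.Icc 1 N, ∏ i, f i k)
      = ∑' j : ℕ, charLProd f p m j * (S (N / p ^ j) / S N) := by
    intro N
    rw [aux_T f p m hf hp N, tsum_eq_sum (s := Finset.range (N + 1)), Finset.sum_div]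
    · refine Finset.sum_congr rfl fun j _ => ?_
      rw [mul_div_assoc]
    · intro j hj
      have h1 : j < p ^ j := Nat.lt_pow_self hp.one_lt
      have h2 : N / p ^ j = 0 := Nat.div_eq_of_lt (by simp at hj; omega)
      rw [h2, hS0]; simp
  simp_rw [hT]
  have hcast : ∀ (j : ℕ) (x : ℝ), ((p ^ j : ℕ) : ℝ) ^ x = (p : ℝ) ^ (x * j) := by
    intro j x
    rw [Nat.cast_pow, ← Real.rpow_natCast, ← Real.rpow_mul hp'.le, mul_comm]
  have hsum : Summable (fun j : ℕ => (K' * C) * ((p : ℝ) ^ (-ε)) ^ j) := by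
    refine (summable_geometric_of_lt_one (by positivity) ?_).mul_left _
    exact Real.rpow_lt_one_of_one_lt_of_neg (by exact_mod_cast hp.one_lt) (by linarith)
  refine tendsto_tsum_of_dominated_convergence hsum ?_ ?_
  · intro j
    have := S_limit S F a1 b1 hF (p ^ j) (pow_pos hp.pos j) hSU
    rw [hcast, neg_mul] at this
    exact this.const_mul _
  · filter_upwards [hb] with N hN j
    have h1 := hN (p ^ j) (pow_pos hp.pos j)
    rw [hcast, hcast] at h1
    rw [Real.norm_eq_abs, abs_mul]
    calc _ ≤ (K' * (p : ℝ) ^ (γ * j)) * (C * ((p : ℝ) ^ (-a1 * j) * (p : ℝ) ^ (ε * j))) := by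
          have := hL' j
          gcongr
      _ = (K' * C) * (p : ℝ) ^ (γ * j + (-a1 * j + ε * j)) := by
          rw [Real.rpow_add hp', Real.rpow_add hp']; ring
      _ = _ := by
          rw [← Real.rpow_natCast, ← Real.rpow_mul hp'.le]
          congr 2
          rw [hε]; ring
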